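/- Let K ⊆ Σ* be a regular trace-closed language. Then K is limit-stable if and only if every I-diamond DFA recognizing K, all of whose states are reachable from the initial state, is F,I-cycle closed. -/

import Mathlib

open Relation

variable {A : Type*} {σ : Type*} {S : Type*}

/-- The length-`n` prefix of an ω-word. -/
def wpre (α : ℕ → A) (n : ℕ) : List A := (List.range n).map α

/-- One swap of two adjacent independent letters. -/
def SwapStep (I : A → A → Prop) (u v : List A) : Prop :=
  ∃ (x y : List A) (a b : A), I a b ∧ u = x ++ a :: b :: y ∧ v = x ++ b :: a :: y

/-- Trace equivalence `∼_I` on finite words: the equivalence closure of adjacent swaps. -/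
def TrEq (I : A → A → Prop) : List A → List A → Prop := EqvGen (SwapStep I)

/-- Trace-prefix relation `u ⊑_I v`. -/
def TrPre (I : A → A → Prop) (u v : List A) : Prop := ∃ w, TrEq I (u ++ w) v

/-- Trace equivalence `≈_I` of ω-words. -/
def OmEq (I : A → A → Prop) (α β : ℕ → A) : Prop :=
  (∀ n, ∃ m, TrPre I (wpre α n) (wpre β m)) ∧ (∀ n, ∃ m, TrPre I (wpre β n) (wpre α m))

/-- A language of finite words is trace-closed. -/
def TraceClosed (I : A → A → Prop) (K : Set (List A)) : Prop :=
  ∀ u v, u ∈ K → TrEq I u v → v ∈ K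

/-- An ω-language is trace-closed. -/
def OmTraceClosed (I : A → A → Prop) (L : Set (ℕ → A)) : Prop :=
  ∀ α β, α ∈ L → OmEq I α β → β ∈ L

/-- `ext(K)`: ω-words with some finite prefix in `K`. -/
def extL (K : Set (List A)) : Set (ℕ → A) := {α | ∃ n, wpre α n ∈ K}

/-- `lim(K)`: ω-words with infinitely many finite prefixes in `K`. -/
def limL (K : Set (List A)) : Set (ℕ → A) := {α | ∀ N, ∃ n ≥ N, wpre α n ∈ K}

/-- `[L]_{≈_I}`: the ω-trace closure of an ω-language. -/
def omCl (I : A → A → Prop) (L : Set (ℕ → A)) : Set (ℕ → A) := {α | ∃ β ∈ L, OmEq I α β}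

/-- The `I`-suffix extension `K_I`. -/
def suffExt (I : A → A → Prop) (K : Set (List A)) : Set (List A) :=
  K ∪ {w | ∃ (a : A) (u x : List A),
    u ++ [a] ∈ K ∧ (∀ b ∈ x, I a b) ∧ TrEq I w (u ++ [a] ++ x)}

/-- A language is regular iff it is recognized by a DFA with finitely many states. -/
def RegularLang (K : Set (List A)) : Prop :=
  ∃ (σ : Type) (_ : Fintype σ) (M : DFA A σ), ∀ w, w ∈ M.accepts ↔ w ∈ K

/-- A DFA is `I`-diamond. -/
def IDiamond (I : A → A → Prop) (M : DFA A σ) : Prop :=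
  ∀ q a b, I a b → M.step (M.step q a) b = M.step (M.step q b) a

/-- The ω-language of a DFA viewed as a deterministic Büchi automaton. -/
def BuchiLang (M : DFA A σ) : Set (ℕ → A) :=
  {α | ∀ N, ∃ n ≥ N, M.evalFrom M.start (wpre α n) ∈ M.accept}

/-- The weakness condition: mutually reachable states agree on acceptance. -/
def IsWeak (M : DFA A σ) : Prop :=
  ∀ q q', (∃ u, M.evalFrom q u = q') → (∃ v, M.evalFrom q' v = q) →
    (q ∈ M.accept ↔ q' ∈ M.accept)

/-- States visited infinitely often by the run of a DFA on an ω-word. -/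
def InfStates (M : DFA A σ) (α : ℕ → A) : Set σ :=
  {q | ∀ N, ∃ n ≥ N, M.evalFrom M.start (wpre α n) = q}

/-- The ω-language of a DFA equipped with a Muller acceptance family. -/
def MullerLang (M : DFA A σ) (F : Set (Set σ)) : Set (ℕ → A) := {α | InfStates M α ∈ F}

/-- An ω-language is ω-regular iff it is recognized by a deterministic Muller automaton. -/
def OmegaRegular (L : Set (ℕ → A)) : Prop :=
  ∃ (σ : Type) (_ : Fintype σ) (M : DFA A σ) (F : Set (Set σ)), MullerLang M F = L

/-- Finite Boolean combinations of a family of sets. -/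
inductive BoolComb {X : Type*} (G : Set (Set X)) : Set X → Prop
  | base {L} : L ∈ G → BoolComb G L
  | compl {L} : BoolComb G L → BoolComb G Lᶜ
  | union {L₁ L₂} : BoolComb G L₁ → BoolComb G L₂ → BoolComb G (L₁ ∪ L₂)
  | inter {L₁ L₂} : BoolComb G L₁ → BoolComb G L₂ → BoolComb G (L₁ ∩ L₂)

/-- `φ : Σ* → S` is a monoid homomorphism (words under concatenation). -/
def IsHom [Monoid S] (φ : List A → S) : Prop :=
  φ [] = 1 ∧ ∀ u v, φ (u ++ v) = φ u * φ v

/-- Linked pair of a monoid. -/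
def LinkedPair [Monoid S] (s e : S) : Prop := s * e = s ∧ e * e = e

/-- The factor `α[i, j)` of an ω-word. -/
def seg (α : ℕ → A) (i j : ℕ) : List A := (List.range (j - i)).map (fun k => α (i + k))

/-- `φ⁻¹(s)·(φ⁻¹(e))^ω`: ω-words admitting a factorization `u·v₁·v₂⋯` with
`φ(u) = s` and `φ(vᵢ) = e`. -/
def LPWords (φ : List A → S) (s e : S) : Set (ℕ → A) :=
  {α | ∃ n : ℕ → ℕ, StrictMono n ∧ φ (wpre α (n 0)) = s ∧
    ∀ i, φ (seg α (n i) (n (i + 1))) = e}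

/-- `φ` saturates an ω-language `L`. -/
def Saturates [Monoid S] (φ : List A → S) (L : Set (ℕ → A)) : Prop :=
  ∀ s e : S, LinkedPair s e → LPWords φ s e ∩ L = ∅ ∨ LPWords φ s e ⊆ L

/-- The `P`-cut property of a linked pair `(s, e)` with respect to `φ`. -/
def PCut [Monoid S] (φ : List A → S) (P : Set S) (s e : S) : Prop :=
  (∀ w : List A, w ≠ [] → φ w = e →
      ∃ j, 1 ≤ j ∧ j ≤ w.length ∧ s * e * φ (w.take j) ∈ P) ∨
  (∀ w : List A, w ≠ [] → φ w = e →
      ∀ j, 1 ≤ j → j ≤ w.length → s * e * φ (w.take j) ∉ P)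

/-- The run from `q` on `u` visits an accepting state (endpoints included). -/
def VisitsAcc (M : DFA A σ) (q : σ) (u : List A) : Prop :=
  ∃ p, p <+: u ∧ M.evalFrom q p ∈ M.accept

/-- `q ⇒_u q'`: the run from `q` on `u` ends in `q'` and visits an accepting state. -/
def FICycleClosed (I : A → A → Prop) (M : DFA A σ) : Prop :=
  ∀ u v q, TrEq I u v →
    ((M.evalFrom q u = q ∧ VisitsAcc M q u) ↔ (M.evalFrom q v = q ∧ VisitsAcc M q v))

section helpers

theorem TrEq.rfl' {I : A → A → Prop} {u : List A} : TrEq I u u := EqvGen.refl _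

theorem TrEq.symm' {I : A → A → Prop} {u v : List A} (h : TrEq I u v) : TrEq I v u :=
  EqvGen.symm _ _ h

theorem TrEq.trans' {I : A → A → Prop} {u v w : List A} (h : TrEq I u v) (h' : TrEq I v w) :
    TrEq I u w := EqvGen.trans _ _ _ h h'

theorem TrEq.left {I : A → A → Prop} {u v : List A} (x : List A) (h : TrEq I u v) :
    TrEq I (x ++ u) (x ++ v) := by
  induction h with
  | rel u v h =>
    obtain ⟨p, q, a, b, hab, rfl, rfl⟩ := h
    exact EqvGen.rel _ _ ⟨x ++ p, q, a, b, hab, by simp, by simp⟩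
  | refl => exact TrEq.rfl'
  | symm _ _ _ ih => exact ih.symm'
  | trans _ _ _ _ _ ih1 ih2 => exact ih1.trans' ih2

theorem TrEq.right {I : A → A → Prop} {u v : List A} (x : List A) (h : TrEq I u v) :
    TrEq I (u ++ x) (v ++ x) := by
  induction h with
  | rel u v h =>
    obtain ⟨p, q, a, b, hab, rfl, rfl⟩ := h
    exact EqvGen.rel _ _ ⟨p, q ++ x, a, b, hab, by simp, by simp⟩
  | refl => exact TrEq.rfl'
  | symm _ _ _ ih => exact ih.symm'
  | trans _ _ _ _ _ ih1 ih2 => exact ih1.trans' ih2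

theorem TrEq.app {I : A → A → Prop} {u v x y : List A} (h : TrEq I u v) (h' : TrEq I x y) :
    TrEq I (u ++ x) (v ++ y) := (h.right x).trans' (h'.left v)

theorem TrEq.length' {I : A → A → Prop} {u v : List A} (h : TrEq I u v) :
    u.length = v.length := by
  induction h with
  | rel u v h => obtain ⟨p, q, a, b, hab, rfl, rfl⟩ := h; simp
  | refl => rfl
  | symm _ _ _ ih => exact ih.symm
  | trans _ _ _ _ _ ih1 ih2 => exact ih1.trans ih2

open Classical in
theorem TrEq.erase' {I : A → A → Prop} (hirr : ∀ a, ¬ I a a) {u v : List A} (c : A)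
    (h : TrEq I u v) : TrEq I (u.erase c) (v.erase c) := by
  induction h with
  | rel u v h =>
    obtain ⟨p, q, a, b, hab, rfl, rfl⟩ := h
    by_cases hc : c ∈ p
    · rw [List.erase_append_left _ hc, List.erase_append_left _ hc]
      exact EqvGen.rel _ _ ⟨p.erase c, q, a, b, hab, rfl, rfl⟩
    · rw [List.erase_append_right _ hc, List.erase_append_right _ hc]
      apply TrEq.left
      have hne : a ≠ b := fun e => hirr a (by rw [← e] at hab; exact hab)
      by_cases h1 : a = c
      · subst h1
        rw [List.erase_cons_head, List.erase_cons_tail (by simpa using hne.symm),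
          List.erase_cons_head]
        exact TrEq.rfl'
      · by_cases h2 : b = c
        · subst h2
          rw [List.erase_cons_head, List.erase_cons_tail (by simpa using hne),
            List.erase_cons_head]
          exact TrEq.rfl'
        · rw [List.erase_cons_tail (by simpa using h1), List.erase_cons_tail (by simpa using h2),
            List.erase_cons_tail (by simpa using h2), List.erase_cons_tail (by simpa using h1)]
          exact EqvGen.rel _ _ ⟨[], _, a, b, hab, rfl, rfl⟩
  | refl => exact TrEq.rfl'
  | symm _ _ _ ih => exact ih.symm'
  | trans _ _ _ _ _ ih1 ih2 => exact ih1.trans' ih2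

theorem TrEq.cancel {I : A → A → Prop} (hirr : ∀ a, ¬ I a a) {u v : List A} (x : List A)
    (h : TrEq I (x ++ u) (x ++ v)) : TrEq I u v := by
  classical
  induction x with
  | nil => exact h
  | cons a x ih =>
    have := h.erase' hirr a
    simp only [List.cons_append, List.erase_cons_head] at this
    exact ih this

theorem TrEq.eval {I : A → A → Prop} {M : DFA A σ} (hM : IDiamond I M) {u v : List A}
    (h : TrEq I u v) (q : σ) : M.evalFrom q u = M.evalFrom q v := by
  induction h generalizing q with
  | rel u v h =>
    obtain ⟨p, r, a, b, hab, rfl, rfl⟩ := h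
    simp only [DFA.evalFrom_of_append, DFA.evalFrom_cons, hM _ a b hab]
  | refl => rfl
  | symm _ _ _ ih => exact (ih q).symm
  | trans _ _ _ _ _ ih1 ih2 => exact (ih1 q).trans (ih2 q)

theorem wpre_length (α : ℕ → A) (n : ℕ) : (wpre α n).length = n := by simp [wpre]

theorem wpre_take (α : ℕ → A) {m n : ℕ} (h : m ≤ n) : (wpre α n).take m = wpre α m := by
  simp [wpre, ← List.map_take, List.take_range, h]

theorem wpre_prefix (α : ℕ → A) {m n : ℕ} (h : m ≤ n) : wpre α m <+: wpre α n := by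
  rw [← wpre_take α h]; exact List.take_prefix _ _

theorem wpre_of_prefix (α : ℕ → A) {x : List A} {n : ℕ} (h : x <+: wpre α n) :
    wpre α x.length = x := by
  have hl : x.length ≤ n := by simpa [wpre_length] using h.length_le
  rw [← wpre_take α hl]; exact (List.prefix_iff_eq_take.mp h).symm

theorem TrPre.trans' {I : A → A → Prop} {u v w : List A} (h : TrPre I u v) (h' : TrPre I v w) :
    TrPre I u w := by
  obtain ⟨x, hx⟩ := h
  obtain ⟨y, hy⟩ := h'
  exact ⟨x ++ y, by rw [← List.append_assoc]; exact (hx.right y).trans' hy⟩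

theorem TrPre.of_prefix {I : A → A → Prop} {u v : List A} (h : u <+: v) : TrPre I u v := by
  obtain ⟨x, hx⟩ := h
  exact ⟨x, by rw [hx]; exact TrEq.rfl'⟩

/-- `w·u^k`. -/
def pumpW (w u : List A) (k : ℕ) : List A := w ++ (List.replicate k u).flatten

theorem pumpW_succ (w u : List A) (k : ℕ) : pumpW w u (k + 1) = pumpW w u k ++ u := by
  simp [pumpW, List.replicate_succ']

theorem pumpW_prefix (w u : List A) {k l : ℕ} (h : k ≤ l) : pumpW w u k <+: pumpW w u l := by
  induction l, h using Nat.le_induction with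
  | base => exact List.prefix_rfl
  | succ l _ ih => rw [pumpW_succ]; exact ih.trans (List.prefix_append _ _)

theorem pumpW_length (w u : List A) (hu : u ≠ []) (k : ℕ) : k ≤ (pumpW w u k).length := by
  induction k with
  | zero => simp
  | succ k ih =>
    have := List.length_pos_iff.mpr hu
    rw [pumpW_succ, List.length_append]; omega

theorem pumpW_trEq {I : A → A → Prop} (w : List A) {u v : List A} (h : TrEq I u v) (k : ℕ) :
    TrEq I (pumpW w u k) (pumpW w v k) := by
  induction k with
  | zero => simp only [pumpW, List.replicate_zero]; exact TrEq.rfl'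
  | succ k ih => rw [pumpW_succ, pumpW_succ]; exact ih.app h

theorem exists_omega (w u : List A) (hu : u ≠ []) :
    ∃ α : ℕ → A, ∀ k, wpre α (pumpW w u k).length = pumpW w u k := by
  refine ⟨fun n => (pumpW w u (n + 1))[n]'(pumpW_length w u hu (n + 1)), fun k => ?_⟩
  apply List.ext_getElem
  · simp [wpre_length]
  · intro i h1 h2
    simp only [wpre, List.getElem_map, List.getElem_range]
    rcases le_total k (i + 1) with h | h
    · exact ((pumpW_prefix w u h).getElem h2).symm
    · exact (pumpW_prefix w u h).getElem _

theorem evalFrom_pumpW (M : DFA A σ) {w u : List A} {q : σ} (hw : M.evalFrom M.start w = q)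
    (hu : M.evalFrom q u = q) (k : ℕ) : M.evalFrom M.start (pumpW w u k) = q := by
  induction k with
  | zero => simpa [pumpW] using hw
  | succ k ih => rw [pumpW_succ, DFA.evalFrom_of_append, ih, hu]

theorem visits_of_pump (M : DFA A σ) {v : List A} {q : σ} (hv : M.evalFrom q v = q) (k : ℕ)
    (x : List A) (hx : x <+: (List.replicate k v).flatten) (ha : M.evalFrom q x ∈ M.accept) :
    VisitsAcc M q v := by
  induction k generalizing x with
  | zero =>
    have : x = [] := by simpa using hx
    subst this
    exact ⟨[], List.nil_prefix, ha⟩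
  | succ k ih =>
    rw [List.replicate_succ, List.flatten_cons] at hx
    rcases List.prefix_or_prefix_of_prefix hx (List.prefix_append v _) with h | ⟨y, rfl⟩
    · exact ⟨x, h, ha⟩
    · rw [List.prefix_append_right_inj] at hx
      rw [DFA.evalFrom_of_append, hv] at ha
      exact ih y hx ha

theorem stmt12_mp {I : A → A → Prop} {K : Set (List A)} (hL : OmTraceClosed I (limL K))
    (M : DFA A σ) (hd : IDiamond I M) (hacc : ∀ w, w ∈ M.accepts ↔ w ∈ K)
    (hr : ∀ q, ∃ u, M.evalFrom M.start u = q) {u v : List A} {q : σ} (huv : TrEq I u v)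
    (hu : M.evalFrom q u = q) (hvis : VisitsAcc M q u) :
    M.evalFrom q v = q ∧ VisitsAcc M q v := by
  have hv : M.evalFrom q v = q := by rw [← huv.eval hd]; exact hu
  refine ⟨hv, ?_⟩
  by_cases hne : u = []
  · have : v = [] := by
      have := huv.length'
      rw [hne] at this
      exact List.length_eq_zero_iff.mp this.symm
    rw [this, ← hne]; exact hvis
  have hvne : v ≠ [] := by
    rintro rfl
    exact hne (List.length_eq_zero_iff.mp huv.length')
  obtain ⟨w, hw⟩ := hr q
  obtain ⟨α, hα⟩ := exists_omega w u hne
  obtain ⟨β, hβ⟩ := exists_omega w v hvne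
  have key : ∀ {x y : List A} {γ δ : ℕ → A}, x ≠ [] → TrEq I x y →
      (∀ k, wpre γ (pumpW w x k).length = pumpW w x k) →
      (∀ k, wpre δ (pumpW w y k).length = pumpW w y k) →
      ∀ n, ∃ m, TrPre I (wpre γ n) (wpre δ m) := by
    intro x y γ δ hx hxy hγ hδ n
    refine ⟨(pumpW w y n).length, ?_⟩
    rw [hδ]
    refine (TrPre.of_prefix (wpre_prefix γ (pumpW_length w x hx n))).trans' ?_
    rw [hγ]
    exact ⟨[], by rw [List.append_nil]; exact pumpW_trEq w hxy n⟩
  have hαL : α ∈ limL K := by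
    intro N
    obtain ⟨p, hp, hpa⟩ := hvis
    have hpre : pumpW w u N ++ p <+: wpre α (pumpW w u (N + 1)).length := by
      rw [hα, pumpW_succ, List.prefix_append_right_inj]; exact hp
    refine ⟨(pumpW w u N ++ p).length, ?_, ?_⟩
    · have := pumpW_length w u hne N
      rw [List.length_append]; omega
    · rw [wpre_of_prefix α hpre, ← hacc, DFA.mem_accepts]
      show M.evalFrom M.start _ ∈ _
      rw [DFA.evalFrom_of_append, evalFrom_pumpW M hw hu]
      exact hpa
  have hβL : β ∈ limL K :=
    hL α β hαL ⟨key hne huv hα hβ, key hvne huv.symm' hβ hα⟩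
  obtain ⟨n, hn, hnK⟩ := hβL w.length
  have h1 : wpre β n <+: pumpW w v n := by
    rw [← hβ n]; exact wpre_prefix β (pumpW_length w v hvne n)
  have h2 : w <+: wpre β n :=
    List.prefix_of_prefix_length_le (List.prefix_append _ _) h1 (by rw [wpre_length]; exact hn)
  obtain ⟨y, hy⟩ := h2
  rw [← hy] at h1 hnK
  rw [pumpW, List.prefix_append_right_inj] at h1
  rw [← hacc, DFA.mem_accepts] at hnK
  replace hnK : M.evalFrom M.start (w ++ y) ∈ M.accept := hnK
  rw [DFA.evalFrom_of_append, hw] at hnK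
  exact visits_of_pump M hv n y h1 hnK

theorem exists_min {I : A → A → Prop} {K : Set (List A)} (hreg : RegularLang K)
    (hK : TraceClosed I K) :
    ∃ (σ : Type) (_ : Fintype σ) (M : DFA A σ),
      IDiamond I M ∧ (∀ w, w ∈ M.accepts ↔ w ∈ K) ∧ (∀ q, ∃ u, M.evalFrom M.start u = q) := by
  let L : Language A := K
  have hLr : L.IsRegular := by
    obtain ⟨σ, hσ, M, hM⟩ := hreg
    exact ⟨σ, hσ, M, by ext w; exact hM w⟩
  have hfin := hLr.finite_range_leftQuotient
  have : Finite (Set.range L.leftQuotient) := hfin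
  obtain ⟨n, ⟨e⟩⟩ := Finite.exists_equiv_fin (Set.range L.leftQuotient)
  refine ⟨Fin n, inferInstance, DFA.reindex e L.toDFA, ?_, ?_, ?_⟩
  · intro q a b hab
    show e (L.toDFA.step (e.symm (e (L.toDFA.step (e.symm q) a))) b) =
      e (L.toDFA.step (e.symm (e (L.toDFA.step (e.symm q) b))) a)
    rw [Equiv.symm_apply_apply, Equiv.symm_apply_apply]
    congr 1
    apply Subtype.ext
    obtain ⟨x, hx⟩ := (e.symm q).2
    simp only [Language.step_toDFA, ← hx]
    ext y
    simp only [Language.mem_leftQuotient]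
    have hsw : TrEq I (x ++ ([a] ++ ([b] ++ y))) (x ++ ([b] ++ ([a] ++ y))) :=
      EqvGen.rel _ _ ⟨x, y, a, b, hab, rfl, rfl⟩
    exact ⟨fun h => hK _ _ h hsw, fun h => hK _ _ h hsw.symm'⟩
  · intro w
    rw [DFA.accepts_reindex, Language.accepts_toDFA]
    exact Iff.rfl
  · intro q
    obtain ⟨x, hx⟩ := (e.symm q).2
    refine ⟨x, ?_⟩
    have hev : ∀ x, (L.toDFA.eval x).val = L.leftQuotient x := by
      intro x
      induction x using List.reverseRecOn with
      | nil => simp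
      | append_singleton x a ih => simp [ih, Language.leftQuotient_append]
    have : (DFA.reindex e L.toDFA).eval x = q := by
      rw [DFA.eval_reindex, Equiv.apply_eq_iff_eq_symm_apply]
      apply Subtype.ext
      rw [hev, hx]
    exact this

theorem stmt12_mpr {I : A → A → Prop} (hirr : ∀ a, ¬ I a a) {K : Set (List A)}
    [Finite σ] (M : DFA A σ) (hd : IDiamond I M) (hacc : ∀ w, w ∈ M.accepts ↔ w ∈ K)
    (hc : FICycleClosed I M) : OmTraceClosed I (limL K) := by
  intro α β hα hαβ N
  have hup : ∀ {γ δ : ℕ → A}, (∀ n, ∃ m, TrPre I (wpre γ n) (wpre δ m)) → ∀ B n, ∃ m,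
      B ≤ m ∧ TrPre I (wpre γ n) (wpre δ m) := by
    intro γ δ h B n
    obtain ⟨m, hm⟩ := h n
    exact ⟨max B m, le_max_left _ _, hm.trans' (TrPre.of_prefix (wpre_prefix δ (le_max_right _ _)))⟩
  choose g hgN hg using hup hαβ.1 N
  choose h hh using hαβ.2
  obtain ⟨⟨q, p⟩, hinf⟩ := Finite.exists_infinite_fiber
    (fun i => (M.evalFrom M.start (wpre α i), M.evalFrom M.start (wpre β (g i))))
  have hinf' := Set.infinite_coe_iff.mp hinf
  have pick : ∀ B, ∃ i, B < i ∧ M.evalFrom M.start (wpre α i) = q ∧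
      M.evalFrom M.start (wpre β (g i)) = p := by
    intro B
    obtain ⟨i, hi, hB⟩ := hinf'.exists_gt B
    have := Prod.ext_iff.mp (show _ = (q, p) from hi)
    exact ⟨i, hB, this.1, this.2⟩
  obtain ⟨n, -, hnq, hnp⟩ := pick 0
  obtain ⟨m, hm, hmq, hmp⟩ := pick (h (g n))
  obtain ⟨t, htm, htK⟩ := hα m
  obtain ⟨l, hl, hlq, hlp⟩ := pick t
  -- z : from the prefix of β to the prefix of α
  obtain ⟨z, hz⟩ : TrPre I (wpre β (g n)) (wpre α m) :=
    (hh (g n)).trans' (TrPre.of_prefix (wpre_prefix α hm.le))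
  obtain ⟨w, hw⟩ := hg l
  obtain ⟨U, hU⟩ := wpre_prefix α (htm.trans hl.le)
  obtain ⟨T, hT⟩ := wpre_prefix α htm
  obtain ⟨R, hR⟩ := wpre_prefix α hl.le
  have hUT : U = T ++ R := by
    apply List.append_cancel_left (as := wpre α m)
    rw [hU, ← hR, ← hT, List.append_assoc]
  have hall : TrEq I (wpre β (g n) ++ (z ++ U ++ w)) (wpre β (g l)) := by
    have h1 : TrEq I (wpre β (g n) ++ z ++ U ++ w) (wpre α m ++ U ++ w) := (hz.right U).right w
    rw [hU] at h1
    simpa only [List.append_assoc] using h1.trans' hw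
  have hle : g n ≤ g l := by
    have := hall.length'
    rw [List.length_append, wpre_length, wpre_length] at this
    omega
  obtain ⟨V, hV⟩ := wpre_prefix β hle
  have hV' : TrEq I (z ++ U ++ w) V := by
    rw [← hV] at hall
    exact hall.cancel hirr
  have hpz : M.evalFrom p z = q := by
    rw [← hnp, ← DFA.evalFrom_of_append, hz.eval hd, hmq]
  have hqU : M.evalFrom q U = q := by
    conv_lhs => rw [← hmq]
    rw [← DFA.evalFrom_of_append, hU, hlq]
  have hqw : M.evalFrom q w = p := by
    rw [← hlq, ← DFA.evalFrom_of_append, hw.eval hd, hlp]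
  have hcyc : M.evalFrom p (z ++ U ++ w) = p := by
    rw [DFA.evalFrom_of_append, DFA.evalFrom_of_append, hpz, hqU, hqw]
  have hvis : VisitsAcc M p (z ++ U ++ w) := by
    refine ⟨z ++ T, ⟨R ++ w, by rw [hUT]; simp⟩, ?_⟩
    rw [DFA.evalFrom_of_append, hpz, ← hmq, ← DFA.evalFrom_of_append, hT]
    exact (hacc _).mpr htK
  obtain ⟨-, x, hx, hxa⟩ := (hc _ V p hV').mp ⟨hcyc, hvis⟩
  have hpre : wpre β (g n) ++ x <+: wpre β (g l) := by
    rw [← hV, List.prefix_append_right_inj]; exact hx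
  refine ⟨(wpre β (g n) ++ x).length, ?_, ?_⟩
  · have := hgN n
    rw [List.length_append, wpre_length]; omega
  · rw [wpre_of_prefix β hpre, ← hacc]
    show M.evalFrom M.start _ ∈ M.accept
    rw [DFA.evalFrom_of_append, hnp]
    exact hxa

end helpers

/-- A regular trace-closed `K` is limit-stable iff every
`I`-diamond DFA recognizing `K` with all states reachable is `F,I`-cycle
closed. -/
theorem stmt12 [Fintype A] (I : A → A → Prop)
    (hirr : ∀ a, ¬ I a a) (hsym : ∀ a b, I a b → I b a)
    (K : Set (List A)) (hreg : RegularLang K) (hK : TraceClosed I K) :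
    OmTraceClosed I (limL K) ↔
    ∀ (σ : Type) (_ : Fintype σ) (M : DFA A σ),
      IDiamond I M → (∀ w, w ∈ M.accepts ↔ w ∈ K) →
      (∀ q, ∃ u, M.evalFrom M.start u = q) → FICycleClosed I M := by
  constructor
  · intro hL σ _ M hd hacc hr u v q huv
    exact ⟨fun h => stmt12_mp hL M hd hacc hr huv h.1 h.2,
      fun h => stmt12_mp hL M hd hacc hr huv.symm' h.1 h.2⟩
  · intro h
    obtain ⟨σ, hσ, M, hd, hacc, hr⟩ := exists_min hreg hK
    exact stmt12_mpr hirr M hd hacc (h σ hσ M hd hacc hr)
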